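/- arXiv:2510.08822 — 2 statements merged into one kernel-verified Lean document; each statement's English description precedes it below -/
import Mathlib

section
/- Let n ≥ 2 and let q : EuclideanSpace ℝ (Fin n) → ℝ be infinitely differentiable with tsupport q contained in the open unit ball 𝔹ⁿ. Then q is radial if and only if for every pair of natural numbers d ≠ e and every pair of polynomials u, v ∈ MvPolynomial (Fin n) ℝ such that u and v are harmonic, u is homogeneous of degree d, and v is homogeneous of degree e, one has ∫_{𝔹ⁿ} q(x) · u(x) · v(x) dx = 0 (integral with respect to Lebesgue measure, u(x) and v(x) denoting evaluation of the polynomials at the coordinates of x). -/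
open MeasureTheory MvPolynomial

theorem MvPolynomial.hasFDerivAt_eval_euclideanSpace {n : ℕ} (p : MvPolynomial (Fin n) ℝ)
    (x : EuclideanSpace ℝ (Fin n)) :
    HasFDerivAt (fun x : EuclideanSpace ℝ (Fin n) => eval (fun i => x i) p)
      (∑ i, eval (fun i => x i) (pderiv i p) •
        (EuclideanSpace.proj i : EuclideanSpace ℝ (Fin n) →L[ℝ] ℝ))
      x := by
  induction p using MvPolynomial.induction_on with
  | C a => simpa using hasFDerivAt_const a x
  | add p q hp hq =>
    simp only [map_add, add_smul, Finset.sum_add_distrib]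
    exact hp.add hq
  | mul_X p j hp =>
    have hX : HasFDerivAt (fun x : EuclideanSpace ℝ (Fin n) => x j)
        (EuclideanSpace.proj j : EuclideanSpace ℝ (Fin n) →L[ℝ] ℝ) x :=
      (EuclideanSpace.proj j : EuclideanSpace ℝ (Fin n) →L[ℝ] ℝ).hasFDerivAt
    have h := hp.mul hX
    simp only [map_mul, eval_X]
    refine h.congr_fderiv ?_
    ext v
    simp [pderiv_X, Pi.single_apply, apply_ite, Finset.mul_sum, add_mul, Finset.sum_add_distrib,
      mul_assoc]

theorem MvPolynomial.continuous_eval_euclideanSpace {n : ℕ} (p : MvPolynomial (Fin n) ℝ) :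
    Continuous (fun x : EuclideanSpace ℝ (Fin n) => eval (fun i => x i) p) :=
  continuous_iff_continuousAt.2 fun x => (p.hasFDerivAt_eval_euclideanSpace x).continuousAt

/-- If the gradient of the compactly supported function `Q` at `x` is `q x • x`, the
partial derivative of `Q * P` in the direction `i` has vanishing integral. -/
theorem integral_radial_gradient_mul_eval {n : ℕ} {q Q : EuclideanSpace ℝ (Fin n) → ℝ}
    (hq : Continuous q) (hqc : HasCompactSupport q) (hQc : HasCompactSupport Q)
    (hQ : ∀ x, HasFDerivAt Q (q x • innerSL ℝ x) x) (i : Fin n) (P : MvPolynomial (Fin n) ℝ) :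
    Integrable (fun x : EuclideanSpace ℝ (Fin n) => q x * x i * eval (fun i => x i) P +
      Q x * eval (fun i => x i) (pderiv i P)) ∧
    ∫ x : EuclideanSpace ℝ (Fin n), (q x * x i * eval (fun i => x i) P +
      Q x * eval (fun i => x i) (pderiv i P)) = 0 := by
  have hQ' : Continuous Q := continuous_iff_continuousAt.2 fun x => (hQ x).continuousAt
  have hxi : Continuous fun x : EuclideanSpace ℝ (Fin n) => x i := by fun_prop
  have hP := P.continuous_eval_euclideanSpace
  have hint : Integrable (fun x : EuclideanSpace ℝ (Fin n) => q x * x i * eval (fun i => x i) P +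
      Q x * eval (fun i => x i) (pderiv i P)) :=
    (((hq.mul hxi).mul hP).integrable_of_hasCompactSupport (hqc.mul_right.mul_right)).add
      ((hQ'.mul (pderiv i P).continuous_eval_euclideanSpace).integrable_of_hasCompactSupport
        hQc.mul_right)
  refine ⟨hint, ?_⟩
  have hderiv := fun x => (hQ x).mul (P.hasFDerivAt_eval_euclideanSpace x)
  have key : ∀ x : EuclideanSpace ℝ (Fin n),
      (Q x • (∑ j, eval (fun i => x i) (pderiv j P) •
          (EuclideanSpace.proj j : EuclideanSpace ℝ (Fin n) →L[ℝ] ℝ)) +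
        eval (fun i => x i) P • (q x • innerSL ℝ x)) (EuclideanSpace.single i 1) =
      q x * x i * eval (fun i => x i) P + Q x * eval (fun i => x i) (pderiv i P) := by
    intro x
    simp [EuclideanSpace.inner_single_right]
    ring
  have := integral_bilinear_hasFDerivAt_right_eq_neg_left_of_integrable
    (μ := (volume : Measure (EuclideanSpace ℝ (Fin n)))) (f := fun _ => (1 : ℝ)) (f' := fun _ => 0)
    (v := EuclideanSpace.single i 1) (B := ContinuousLinearMap.mul ℝ ℝ)
    (by simp) (by simpa only [key, ContinuousLinearMap.mul_apply', one_mul] using hint)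
    (by simpa only [ContinuousLinearMap.mul_apply', one_mul] using
      (hQ'.mul hP).integrable_of_hasCompactSupport hQc.mul_right)
    (fun x _ => hasFDerivAt_const _ _) (fun x _ => hderiv x)
  simpa only [key, ContinuousLinearMap.mul_apply', one_mul, zero_mul, integral_zero, neg_zero,
    zero_apply] using this

theorem exists_radial_potential {n : ℕ} {q : EuclideanSpace ℝ (Fin n) → ℝ}
    (i₀ : Fin n) (hq : Continuous q) (hsupp : tsupport q ⊆ Metric.ball 0 1)
    (hrad : ∀ x y : EuclideanSpace ℝ (Fin n), ‖x‖ = ‖y‖ → q x = q y) :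
    ∃ Q : EuclideanSpace ℝ (Fin n) → ℝ, HasCompactSupport Q ∧
      ∀ x, HasFDerivAt Q (q x • innerSL ℝ x) x := by
  set f : ℝ → ℝ := fun t => q (EuclideanSpace.single i₀ (Real.sqrt t)) with hf
  have hfc : Continuous f := by
    have : Continuous fun t : ℝ => EuclideanSpace.single i₀ (Real.sqrt t) :=
      (PiLp.continuous_toLp 2 _).comp
        ((continuous_single (A := fun _ : Fin n => ℝ) i₀).comp Real.continuous_sqrt)
    exact hq.comp this
  have hf0 : ∀ t, 1 ≤ t → f t = 0 := by
    intro t ht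
    refine image_eq_zero_of_notMem_tsupport (f := q) fun h => ?_
    have := hsupp h
    simp [Real.sqrt_nonneg, abs_of_nonneg] at this
    linarith [Real.one_le_sqrt.2 ht]
  have hfx : ∀ x : EuclideanSpace ℝ (Fin n), f (‖x‖ ^ 2) = q x := fun x =>
    hrad _ _ (by simp)
  set G : ℝ → ℝ := fun t => (∫ s in (1 : ℝ)..t, f s) / 2 with hG
  have hGd : ∀ t, HasDerivAt G (f t / 2) t := fun t =>
    (intervalIntegral.integral_hasDerivAt_right (hfc.intervalIntegrable _ _)
      (hfc.stronglyMeasurableAtFilter _ _) hfc.continuousAt).div_const 2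
  refine ⟨fun x => G (‖x‖ ^ 2), ?_, fun x => ?_⟩
  · refine HasCompactSupport.intro (isCompact_closedBall (0 : EuclideanSpace ℝ (Fin n)) 1)
      fun x hx => ?_
    have hx' : 1 < ‖x‖ := by simpa using hx
    have h1 : (1 : ℝ) ≤ ‖x‖ ^ 2 := by nlinarith
    have : ∫ s in (1 : ℝ)..‖x‖ ^ 2, f s = ∫ s in (1 : ℝ)..‖x‖ ^ 2, (0 : ℝ) := by
      refine intervalIntegral.integral_congr fun s hs => ?_
      rw [Set.uIcc_of_le h1] at hs
      exact hf0 s hs.1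
    simp [hG, this]
  · have h := (hGd (‖x‖ ^ 2)).comp_hasFDerivAt x (hasStrictFDerivAt_norm_sq x).hasFDerivAt
    refine h.congr_fderiv ?_
    ext v
    simp [hfx]
    ring

theorem integral_radial_mul_harmonic_mul_harmonic {n : ℕ} {q : EuclideanSpace ℝ (Fin n) → ℝ}
    (i₀ : Fin n) (hq : Continuous q) (hsupp : tsupport q ⊆ Metric.ball 0 1)
    (hrad : ∀ x y : EuclideanSpace ℝ (Fin n), ‖x‖ = ‖y‖ → q x = q y)
    {d e : ℕ} (hde : d ≠ e) {u v : MvPolynomial (Fin n) ℝ}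
    (hu : ∑ i, pderiv i (pderiv i u) = 0) (hv : ∑ i, pderiv i (pderiv i v) = 0)
    (hud : u.IsHomogeneous d) (hve : v.IsHomogeneous e) :
    ∫ x : EuclideanSpace ℝ (Fin n), q x * eval (fun i => x i) u * eval (fun i => x i) v = 0 := by
  obtain ⟨Q, hQc, hQ⟩ := exists_radial_potential i₀ hq hsupp hrad
  have hqc : HasCompactSupport q :=
    (isCompact_closedBall (0 : EuclideanSpace ℝ (Fin n)) 1).of_isClosed_subset
      (isClosed_tsupport q) (hsupp.trans Metric.ball_subset_closedBall)
  have h := fun i => integral_radial_gradient_mul_eval hq hqc hQc hQ i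
    (u * pderiv i v - v * pderiv i u)
  have hsum := integral_finsetSum Finset.univ fun i _ => (h i).1
  rw [Finset.sum_eq_zero fun i _ => (h i).2] at hsum
  have key : ∀ x : EuclideanSpace ℝ (Fin n),
      ∑ i, (q x * x i * eval (fun i => x i) (u * pderiv i v - v * pderiv i u) +
        Q x * eval (fun i => x i) (pderiv i (u * pderiv i v - v * pderiv i u))) =
      ((e : ℝ) - d) * (q x * eval (fun i => x i) u * eval (fun i => x i) v) := by
    intro x
    have eu := congrArg (eval fun i => x i) hud.sum_X_mul_pderiv
    have ev := congrArg (eval fun i => x i) hve.sum_X_mul_pderiv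
    have lu := congrArg (eval fun i => x i) hu
    have lv := congrArg (eval fun i => x i) hv
    simp only [map_sum, map_mul, eval_X, nsmul_eq_mul, map_natCast, map_zero] at eu ev lu lv
    set U := eval (fun i => x i) u
    set V := eval (fun i => x i) v
    calc _ = q x * U * ∑ i, x i * eval (fun i => x i) (pderiv i v)
          - q x * V * ∑ i, x i * eval (fun i => x i) (pderiv i u)
          + Q x * U * ∑ i, eval (fun i => x i) (pderiv i (pderiv i v))
          - Q x * V * ∑ i, eval (fun i => x i) (pderiv i (pderiv i u)) := by
            simp only [Finset.mul_sum, ← Finset.sum_sub_distrib, ← Finset.sum_add_distrib]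
            refine Finset.sum_congr rfl fun i _ => ?_
            simp only [pderiv_mul, map_sub, map_mul, map_add]
            ring
      _ = _ := by rw [eu, ev, lu, lv]; ring
  simp only [key] at hsum
  rw [integral_const_mul] at hsum
  refine (mul_eq_zero.1 hsum).resolve_left (sub_ne_zero.2 ?_)
  exact_mod_cast hde.symm

/-- The real and imaginary parts of `(∑ i, (a i + b i * I) * X i) ^ k`. -/
noncomputable def planePowerReIm {n : ℕ} (a b : Fin n → ℝ) :
    ℕ → MvPolynomial (Fin n) ℝ × MvPolynomial (Fin n) ℝ
  | 0 => (1, 0)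
  | k + 1 =>
    ((planePowerReIm a b k).1 * (∑ i, C (a i) * X i) -
        (planePowerReIm a b k).2 * (∑ i, C (b i) * X i),
      (planePowerReIm a b k).1 * (∑ i, C (b i) * X i) +
        (planePowerReIm a b k).2 * (∑ i, C (a i) * X i))

theorem isHomogeneous_sum_C_mul_X {n : ℕ} (a : Fin n → ℝ) :
    (∑ i, C (a i) * X i : MvPolynomial (Fin n) ℝ).IsHomogeneous 1 :=
  IsHomogeneous.sum _ _ _ fun _ _ => isHomogeneous_C_mul_X _ _

theorem isHomogeneous_planePowerReIm {n : ℕ} (a b : Fin n → ℝ) (k : ℕ) :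
    (planePowerReIm a b k).1.IsHomogeneous k ∧ (planePowerReIm a b k).2.IsHomogeneous k := by
  induction k with
  | zero => exact ⟨isHomogeneous_one _ _, isHomogeneous_zero _ _ _⟩
  | succ k ih =>
    have ha := isHomogeneous_sum_C_mul_X a
    have hb := isHomogeneous_sum_C_mul_X b
    exact ⟨(ih.1.mul ha).sub (ih.2.mul hb), (ih.1.mul hb).add (ih.2.mul ha)⟩

theorem eval_planePowerReIm {n : ℕ} (a b x : Fin n → ℝ) (k : ℕ) :
    (⟨eval x (planePowerReIm a b k).1, eval x (planePowerReIm a b k).2⟩ : ℂ) =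
      (⟨∑ i, a i * x i, ∑ i, b i * x i⟩ : ℂ) ^ k := by
  induction k with
  | zero => apply Complex.ext <;> simp [planePowerReIm]
  | succ k ih => rw [pow_succ, ← ih]; apply Complex.ext <;> simp [planePowerReIm]

theorem pderiv_sum_C_mul_X {n : ℕ} (a : Fin n → ℝ) (i : Fin n) :
    pderiv i (∑ j, C (a j) * X j : MvPolynomial (Fin n) ℝ) = C (a i) := by
  simp [pderiv_X, Pi.single_apply]

theorem pderiv_planePowerReIm_succ {n : ℕ} (a b : Fin n → ℝ) (k : ℕ) (i : Fin n) :
    pderiv i (planePowerReIm a b (k + 1)).1 =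
        (k + 1 : MvPolynomial (Fin n) ℝ) * (C (a i) * (planePowerReIm a b k).1 -
          C (b i) * (planePowerReIm a b k).2) ∧
      pderiv i (planePowerReIm a b (k + 1)).2 =
        (k + 1 : MvPolynomial (Fin n) ℝ) * (C (b i) * (planePowerReIm a b k).1 +
          C (a i) * (planePowerReIm a b k).2) := by
  induction k with
  | zero =>
    simp [planePowerReIm, pderiv_X, Pi.single_apply]
  | succ k ih =>
    rw [planePowerReIm]
    simp only [map_sub, map_add, pderiv_mul, ih.1, ih.2, pderiv_sum_C_mul_X]
    rw [planePowerReIm]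
    push_cast
    constructor <;> ring

theorem laplacian_planePowerReIm {n : ℕ} {a b : Fin n → ℝ} (hab : ∑ i, a i * b i = 0)
    (h : ∑ i, a i * a i = ∑ i, b i * b i) (k : ℕ) :
    ∑ i, pderiv i (pderiv i (planePowerReIm a b k).1) = 0 ∧
      ∑ i, pderiv i (pderiv i (planePowerReIm a b k).2) = 0 := by
  have hab' : ∑ i, (C (a i) * C (b i) : MvPolynomial (Fin n) ℝ) = 0 := by
    simp only [← C_mul, ← map_sum, hab, C_0]
  have h' : ∑ i, (C (a i) * C (a i) : MvPolynomial (Fin n) ℝ) = ∑ i, C (b i) * C (b i) := by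
    simp only [← C_mul, ← map_sum, h]
  have hk (k : ℕ) (i : Fin n) : pderiv i (k + 1 : MvPolynomial (Fin n) ℝ) = 0 := by
    simp
  rcases k with _ | _ | k
  · simp [planePowerReIm]
  · simp only [pderiv_planePowerReIm_succ]
    simp [planePowerReIm]
  · simp only [pderiv_planePowerReIm_succ, pderiv_mul, hk, map_sub, map_add, pderiv_C]
    set A := (planePowerReIm a b k).1
    set B := (planePowerReIm a b k).2
    set c : MvPolynomial (Fin n) ℝ := ((k + 1 : ℕ) + 1) * (k + 1)
    constructor
    · calc _ = c * A * (∑ i, C (a i) * C (a i) - ∑ i, C (b i) * C (b i))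
            - 2 * c * B * ∑ i, C (a i) * C (b i) := by
              simp only [Finset.mul_sum, ← Finset.sum_sub_distrib]
              refine Finset.sum_congr rfl fun i _ => ?_
              simp only [c]; ring
        _ = 0 := by rw [h', hab']; ring
    · calc _ = c * B * (∑ i, C (a i) * C (a i) - ∑ i, C (b i) * C (b i))
            + 2 * c * A * ∑ i, C (a i) * C (b i) := by
              simp only [Finset.mul_sum, ← Finset.sum_sub_distrib, ← Finset.sum_add_distrib]
              refine Finset.sum_congr rfl fun i _ => ?_
              simp only [c]; ring
        _ = 0 := by rw [h', hab']; ring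

theorem integral_mul_planePower_mul_conj_eq_zero {n : ℕ} {q : EuclideanSpace ℝ (Fin n) → ℝ}
    (hq : Continuous q) (hqc : HasCompactSupport q)
    (H : ∀ (d e : ℕ), d ≠ e → ∀ u v : MvPolynomial (Fin n) ℝ,
        (∑ i, pderiv i (pderiv i u) = 0) → (∑ i, pderiv i (pderiv i v) = 0) →
        u.IsHomogeneous d → v.IsHomogeneous e →
        ∫ x : EuclideanSpace ℝ (Fin n),
          q x * eval (fun i => x i) u * eval (fun i => x i) v = 0)
    {a b : EuclideanSpace ℝ (Fin n)} (hab : inner ℝ a b = 0) (h : ‖a‖ = ‖b‖) {j l : ℕ}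
    (hjl : j ≠ l) :
    ∫ x : EuclideanSpace ℝ (Fin n), (q x : ℂ) * ((⟨inner ℝ a x, inner ℝ b x⟩ : ℂ) ^ j *
      (starRingEnd ℂ) (⟨inner ℝ a x, inner ℝ b x⟩ : ℂ) ^ l) = 0 := by
  have hab' : ∑ i, a i * b i = 0 := by
    simpa [PiLp.inner_apply, mul_comm] using hab
  have h' : ∑ i, a i * a i = ∑ i, b i * b i := by
    have : ‖a‖ ^ 2 = ‖b‖ ^ 2 := by rw [h]
    rw [EuclideanSpace.norm_sq_eq, EuclideanSpace.norm_sq_eq] at this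
    simpa only [Real.norm_eq_abs, abs_mul_abs_self, pow_two] using this
  have hlap := laplacian_planePowerReIm hab' h'
  have hhom := isHomogeneous_planePowerReIm a b
  have hint (u v : MvPolynomial (Fin n) ℝ) : Integrable fun x : EuclideanSpace ℝ (Fin n) =>
      q x * eval (fun i => x i) u * eval (fun i => x i) v :=
    ((hq.mul u.continuous_eval_euclideanSpace).mul
      v.continuous_eval_euclideanSpace).integrable_of_hasCompactSupport hqc.mul_right.mul_right
  set A := fun k => (planePowerReIm a b k).1
  set B := fun k => (planePowerReIm a b k).2
  have key (x : EuclideanSpace ℝ (Fin n)) :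
      (q x : ℂ) * ((⟨inner ℝ a x, inner ℝ b x⟩ : ℂ) ^ j *
        (starRingEnd ℂ) (⟨inner ℝ a x, inner ℝ b x⟩ : ℂ) ^ l) =
      ((q x * eval (fun i => x i) (A j) * eval (fun i => x i) (A l) +
        q x * eval (fun i => x i) (B j) * eval (fun i => x i) (B l) : ℝ) : ℂ) +
      ((q x * eval (fun i => x i) (B j) * eval (fun i => x i) (A l) -
        q x * eval (fun i => x i) (A j) * eval (fun i => x i) (B l) : ℝ) : ℂ) * Complex.I := by
    have hz : (⟨inner ℝ a x, inner ℝ b x⟩ : ℂ) = ⟨∑ i, a i * x i, ∑ i, b i * x i⟩ := by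
      simp [PiLp.inner_apply, mul_comm]
    rw [hz, ← map_pow, ← eval_planePowerReIm, ← eval_planePowerReIm]
    apply Complex.ext <;> simp [A, B] <;> ring
  have hre : ∫ x : EuclideanSpace ℝ (Fin n),
      (q x * eval (fun i => x i) (A j) * eval (fun i => x i) (A l) +
        q x * eval (fun i => x i) (B j) * eval (fun i => x i) (B l)) = 0 := by
    rw [integral_add (hint _ _) (hint _ _),
      H j l hjl _ _ (hlap j).1 (hlap l).1 (hhom j).1 (hhom l).1,
      H j l hjl _ _ (hlap j).2 (hlap l).2 (hhom j).2 (hhom l).2, add_zero]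
  have him : ∫ x : EuclideanSpace ℝ (Fin n),
      (q x * eval (fun i => x i) (B j) * eval (fun i => x i) (A l) -
        q x * eval (fun i => x i) (A j) * eval (fun i => x i) (B l)) = 0 := by
    rw [integral_sub (hint _ _) (hint _ _),
      H j l hjl _ _ (hlap j).2 (hlap l).1 (hhom j).2 (hhom l).1,
      H j l hjl _ _ (hlap j).1 (hlap l).2 (hhom j).1 (hhom l).2, sub_zero]
  simp only [key]
  rw [integral_add, integral_mul_const, integral_complex_ofReal, integral_complex_ofReal, hre, him]
  · simp
  · exact ((hint _ _).add (hint _ _)).ofReal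
  · exact ((hint _ _).sub (hint _ _)).ofReal.mul_const _

/-- If the mixed moments of `z = ⟪a, x⟫ + ⟪b, x⟫ * I` against `q` vanish off the diagonal, the
moments of `⟪c • a + s • b, x⟫`, with `(c, s)` on the unit circle, agree with those of `⟪a, x⟫`. -/
theorem integral_mul_inner_rotation_pow {n : ℕ} {q : EuclideanSpace ℝ (Fin n) → ℝ}
    (hq : Continuous q) (hqc : HasCompactSupport q) {a b : EuclideanSpace ℝ (Fin n)}
    (hz : ∀ j l : ℕ, j ≠ l →
      ∫ x : EuclideanSpace ℝ (Fin n), (q x : ℂ) * ((⟨inner ℝ a x, inner ℝ b x⟩ : ℂ) ^ j *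
        (starRingEnd ℂ) (⟨inner ℝ a x, inner ℝ b x⟩ : ℂ) ^ l) = 0)
    {c s : ℝ} (hcs : c ^ 2 + s ^ 2 = 1) (k : ℕ) :
    ∫ x : EuclideanSpace ℝ (Fin n), q x * inner ℝ (c • a + s • b) x ^ k =
      ∫ x : EuclideanSpace ℝ (Fin n), q x * inner ℝ a x ^ k := by
  set z : EuclideanSpace ℝ (Fin n) → ℂ := fun x => ⟨inner ℝ a x, inner ℝ b x⟩ with hzdef
  have hzc : Continuous z := by
    have : z = fun x => ((inner ℝ a x : ℝ) : ℂ) + ((inner ℝ b x : ℝ) : ℂ) * Complex.I := by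
      funext x; exact Complex.mk_eq_add_mul_I _ _
    rw [this]; fun_prop
  have hint (j l : ℕ) : Integrable fun x => (q x : ℂ) * (z x ^ j * (starRingEnd ℂ) (z x) ^ l) := by
    refine Continuous.integrable_of_hasCompactSupport ?_ ?_
    · have := Complex.continuous_conj.comp hzc
      exact (Complex.continuous_ofReal.comp hq).mul ((hzc.pow j).mul (this.pow l))
    · exact (hqc.comp_left (g := ((↑) : ℝ → ℂ)) Complex.ofReal_zero).mul_right
  have expand (c s : ℝ) (hcs : c ^ 2 + s ^ 2 = 1) :
      ((∫ x : EuclideanSpace ℝ (Fin n), q x * inner ℝ (c • a + s • b) x ^ k : ℝ) : ℂ) =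
      ∑ m ∈ Finset.range (k + 1), if m = k - m then (1 / 2 : ℂ) ^ k * (k.choose m) *
        ∫ x, (q x : ℂ) * (z x ^ m * (starRingEnd ℂ) (z x) ^ (k - m)) else 0 := by
    set w : ℂ := ⟨c, -s⟩ with hw
    have hww : w * (starRingEnd ℂ) w = 1 := by
      rw [Complex.mul_conj, Complex.normSq_mk]
      norm_cast
      nlinarith
    have hpt (x : EuclideanSpace ℝ (Fin n)) :
        ((q x * inner ℝ (c • a + s • b) x ^ k : ℝ) : ℂ) =
        ∑ m ∈ Finset.range (k + 1), (1 / 2 : ℂ) ^ k * (k.choose m) *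
          (w ^ m * (starRingEnd ℂ) w ^ (k - m)) *
          ((q x : ℂ) * (z x ^ m * (starRingEnd ℂ) (z x) ^ (k - m))) := by
      have : ((inner ℝ (c • a + s • b) x : ℝ) : ℂ) =
          (1 / 2) * (w * z x + (starRingEnd ℂ) w * (starRingEnd ℂ) (z x)) := by
        apply Complex.ext <;> simp [w, z, inner_add_left, inner_smul_left] <;> ring
      rw [Complex.ofReal_mul, Complex.ofReal_pow, this, mul_pow, add_pow, Finset.mul_sum,
        Finset.mul_sum]
      refine Finset.sum_congr rfl fun m _ => ?_
      rw [mul_pow, mul_pow]; ring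
    rw [← integral_complex_ofReal]
    simp only [hpt]
    rw [integral_finsetSum _ fun m _ => (hint _ _).const_mul _]
    refine Finset.sum_congr rfl fun m _ => ?_
    rw [integral_const_mul]
    split_ifs with hm
    · rw [← hm, ← mul_pow w, hww, one_pow, mul_one]
    · rw [hz m (k - m) hm, mul_zero]
  have h1 := expand c s hcs
  have h2 := expand 1 0 (by norm_num)
  rw [← h2] at h1
  simpa using Complex.ofReal_injective h1

theorem exists_norm_eq_inner_eq_zero {n : ℕ} (hn : 2 ≤ n) (a : EuclideanSpace ℝ (Fin n)) :
    ∃ b : EuclideanSpace ℝ (Fin n), ‖a‖ = ‖b‖ ∧ inner ℝ a b = 0 := by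
  have : ∃ v : EuclideanSpace ℝ (Fin n), v ≠ 0 ∧ inner ℝ a v = 0 := by
    have hne : (ℝ ∙ a)ᗮ ≠ ⊥ := by
      intro h
      have h1 := Submodule.finrank_add_finrank_orthogonal (ℝ ∙ a)
      rw [h, finrank_bot, finrank_euclideanSpace_fin] at h1
      have := finrank_span_le_card (R := ℝ) ({a} : Set (EuclideanSpace ℝ (Fin n)))
      rw [Set.toFinset_singleton, Finset.card_singleton] at this
      omega
    obtain ⟨v, hv, hv0⟩ := Submodule.exists_mem_ne_zero_of_ne_bot hne
    exact ⟨v, hv0, Submodule.mem_orthogonal_singleton_iff_inner_right.1 hv⟩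
  obtain ⟨v, hv0, hv⟩ := this
  refine ⟨(‖a‖ / ‖v‖) • v, ?_, by rw [inner_smul_right, hv, mul_zero]⟩
  have := norm_ne_zero_iff.2 hv0
  rw [norm_smul, Real.norm_of_nonneg (by positivity)]
  field_simp

theorem exists_rotation_of_norm_eq {n : ℕ} (hn : 2 ≤ n) {a y : EuclideanSpace ℝ (Fin n)}
    (h : ‖a‖ = ‖y‖) :
    ∃ (b : EuclideanSpace ℝ (Fin n)) (c s : ℝ), inner ℝ a b = 0 ∧ ‖a‖ = ‖b‖ ∧
      c ^ 2 + s ^ 2 = 1 ∧ y = c • a + s • b := by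
  by_cases ha : a = 0
  · have hy : y = 0 := by rw [← norm_eq_zero, ← h, ha, norm_zero]
    exact ⟨0, 1, 0, by simp [ha, hy]⟩
  have ha' : ‖a‖ ≠ 0 := norm_ne_zero_iff.2 ha
  set c := inner ℝ a y / ‖a‖ ^ 2 with hc
  set r := y - c • a with hr
  have hyr : y = c • a + r := by rw [hr]; abel
  have har : inner ℝ a r = 0 := by
    rw [hr, inner_sub_right, inner_smul_right, real_inner_self_eq_norm_sq, hc]
    field_simp
    ring
  have hnorm : ‖a‖ ^ 2 = c ^ 2 * ‖a‖ ^ 2 + ‖r‖ ^ 2 := by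
    conv_lhs => rw [h, hyr]
    rw [norm_add_sq_real, inner_smul_left, har, norm_smul, mul_pow, Real.norm_eq_abs, sq_abs]
    simp
  by_cases hr0 : r = 0
  · obtain ⟨b, hb, hab⟩ := exists_norm_eq_inner_eq_zero hn a
    refine ⟨b, c, 0, hab, hb, ?_, by rw [hyr, hr0]; simp⟩
    rw [hr0, norm_zero] at hnorm
    have : (c ^ 2 - 1) * ‖a‖ ^ 2 = 0 := by linarith
    have := (mul_eq_zero.1 this).resolve_right (pow_ne_zero 2 ha')
    linarith
  · have hr' : ‖r‖ ≠ 0 := norm_ne_zero_iff.2 hr0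
    refine ⟨(‖a‖ / ‖r‖) • r, c, ‖r‖ / ‖a‖, by rw [inner_smul_right, har, mul_zero], ?_, ?_, ?_⟩
    · rw [norm_smul, Real.norm_of_nonneg (by positivity)]
      field_simp
    · field_simp
      linarith
    · rw [smul_smul, div_mul_div_cancel₀ ha', div_self hr', one_smul, ← hyr]

open FourierTransform in
/-- A continuous function supported in the unit ball is determined by its moments. -/
theorem eq_zero_of_integral_mul_inner_pow_eq_zero {n : ℕ} {g : EuclideanSpace ℝ (Fin n) → ℝ}
    (hg : Continuous g) (hsupp : ∀ x, 1 < ‖x‖ → g x = 0)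
    (hmom : ∀ (a : EuclideanSpace ℝ (Fin n)) (k : ℕ),
      ∫ x : EuclideanSpace ℝ (Fin n), g x * inner ℝ a x ^ k = 0) : g = 0 := by
  have hgc : HasCompactSupport g :=
    HasCompactSupport.intro (isCompact_closedBall (0 : EuclideanSpace ℝ (Fin n)) 1)
      fun x hx => hsupp x (by simpa using hx)
  have hgi : Integrable g := hg.integrable_of_hasCompactSupport hgc
  set f : EuclideanSpace ℝ (Fin n) → ℂ := fun x => (g x : ℂ) with hf
  have hfc : Continuous f := Complex.continuous_ofReal.comp hg
  have hF : 𝓕 f = 0 := by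
    funext w
    set t : EuclideanSpace ℝ (Fin n) → ℂ := fun x => -2 * Real.pi * inner ℝ w x * Complex.I
    set F : ℕ → EuclideanSpace ℝ (Fin n) → ℂ := fun k x => t x ^ k / (k.factorial : ℂ) * f x
    have htc : Continuous t := by fun_prop
    have hFint (k : ℕ) : Integrable (F k) := by
      refine Continuous.integrable_of_hasCompactSupport (by fun_prop) ?_
      exact (hgc.comp_left (g := ((↑) : ℝ → ℂ)) Complex.ofReal_zero).mul_left
    have hbound (k : ℕ) (x) : ‖F k x‖ ≤ (2 * Real.pi * ‖w‖) ^ k / k.factorial * ‖g x‖ := by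
      by_cases hx : 1 < ‖x‖
      · simp [F, f, hsupp x hx]
      · have ht : ‖t x‖ ≤ 2 * Real.pi * ‖w‖ := by
          have h1 := abs_real_inner_le_norm w x
          have h2 : ‖w‖ * ‖x‖ ≤ ‖w‖ := mul_le_of_le_one_right (norm_nonneg _) (not_lt.1 hx)
          have : ‖t x‖ = 2 * Real.pi * |inner ℝ w x| := by
            simp [t, abs_of_pos Real.pi_pos]
          rw [this]
          gcongr
          exact h1.trans h2
        simp only [F, f, norm_mul, norm_div, norm_pow, Complex.norm_natCast, Complex.norm_real]
        gcongr
    have hsum : Summable fun k => ∫ x, ‖F k x‖ := by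
      refine Summable.of_nonneg_of_le (fun k => integral_nonneg fun x => norm_nonneg _)
        (fun k => integral_mono (hFint k).norm (hgi.norm.const_mul _) (hbound k)) ?_
      simp only [integral_const_mul]
      exact (Real.summable_pow_div_factorial _).mul_right _
    have hzero (k : ℕ) : ∫ x, F k x = 0 := by
      have hFx (x) : F k x = (-2 * Real.pi * Complex.I) ^ k / (k.factorial : ℂ) *
          ((g x * inner ℝ w x ^ k : ℝ) : ℂ) := by
        simp only [F, t, f]; push_cast; rw [mul_right_comm _ _ Complex.I, mul_pow]; ring
      simp only [hFx]
      rw [integral_const_mul, integral_complex_ofReal, hmom w k]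
      simp
    have hs := hasSum_integral_of_summable_integral_norm hFint hsum
    simp only [hzero] at hs
    have h0 := hs.unique hasSum_zero
    rw [Real.fourier_eq', Pi.zero_apply, ← h0]
    congr 1
    funext x
    have : HasSum (fun k => F k x) (Complex.exp (t x) * f x) := by
      have := NormedSpace.expSeries_div_hasSum_exp (t x)
      rw [← Complex.exp_eq_exp_ℂ] at this
      exact this.mul_right _
    rw [this.tsum_eq, smul_eq_mul]
    congr 2
    simp only [t]
    rw [real_inner_comm]
    push_cast
    rfl
  have hinv := hfc.fourierInv_fourier_eq hgi.ofReal (by rw [hF]; exact integrable_zero _ _ _)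
  funext x
  have := congrFun hinv x
  rw [hF, Real.fourierInv_eq'] at this
  simpa [f] using this.symm

theorem radial_of_integral_mul_inner_pow_eq {n : ℕ} {q : EuclideanSpace ℝ (Fin n) → ℝ}
    (hq : Continuous q) (hsupp : ∀ x, 1 < ‖x‖ → q x = 0)
    (hmom : ∀ (a b : EuclideanSpace ℝ (Fin n)) (k : ℕ), ‖a‖ = ‖b‖ →
      ∫ x : EuclideanSpace ℝ (Fin n), q x * inner ℝ a x ^ k =
        ∫ x : EuclideanSpace ℝ (Fin n), q x * inner ℝ b x ^ k)
    {x y : EuclideanSpace ℝ (Fin n)} (hxy : ‖x‖ = ‖y‖) : q x = q y := by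
  have hqc : HasCompactSupport q :=
    HasCompactSupport.intro (isCompact_closedBall (0 : EuclideanSpace ℝ (Fin n)) 1)
      fun x hx => hsupp x (by simpa using hx)
  set R := (ℝ ∙ (x - y))ᗮ.reflection
  have hR : R x = y := Submodule.reflection_sub hxy
  have hg : (fun x => q x - q (R x)) = 0 := by
    refine eq_zero_of_integral_mul_inner_pow_eq_zero (hq.sub (hq.comp R.continuous))
      (fun x hx => ?_) fun a k => ?_
    · rw [hsupp x hx, hsupp (R x) (by rwa [R.norm_map]), sub_zero]
    · have hint (a : EuclideanSpace ℝ (Fin n)) :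
          Integrable fun x : EuclideanSpace ℝ (Fin n) => q x * inner ℝ a x ^ k :=
        Continuous.integrable_of_hasCompactSupport (by fun_prop) hqc.mul_right
      have hinner (x) : inner ℝ (R a) (R x) = inner ℝ a x := R.inner_map_map a x
      have hintR : Integrable fun x : EuclideanSpace ℝ (Fin n) => q (R x) * inner ℝ a x ^ k := by
        simpa only [hinner, Function.comp_def] using
          R.measurePreserving.integrable_comp_of_integrable (hint (R a))
      have hcomp := R.measurePreserving.integral_comp' (f := R.toMeasurableEquiv)
        fun x => q x * inner ℝ (R a) x ^ k
      simp only [LinearIsometryEquiv.coe_toMeasurableEquiv, hinner] at hcomp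
      simp only [sub_mul]
      rw [integral_sub (hint a) hintR, hcomp, hmom a (R a) k (R.norm_map a).symm, sub_self]
  rw [← hR]
  exact sub_eq_zero.1 (congrFun hg x)


theorem stmt0 (n : ℕ) (hn : 2 ≤ n) (q : EuclideanSpace ℝ (Fin n) → ℝ)
    (hq : ContDiff ℝ (⊤ : ℕ∞) q)
    (hsupp : tsupport q ⊆ Metric.ball (0 : EuclideanSpace ℝ (Fin n)) 1) :
    (∀ x y : EuclideanSpace ℝ (Fin n), ‖x‖ = ‖y‖ → q x = q y) ↔
      ∀ (d e : ℕ), d ≠ e → ∀ u v : MvPolynomial (Fin n) ℝ,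
        (∑ i, pderiv i (pderiv i u) = 0) → (∑ i, pderiv i (pderiv i v) = 0) →
        u.IsHomogeneous d → v.IsHomogeneous e →
        ∫ x in Metric.ball (0 : EuclideanSpace ℝ (Fin n)) 1,
          q x * eval (fun i => x i) u * eval (fun i => x i) v = 0 := by
  have hq' := hq.continuous
  have hout (x : EuclideanSpace ℝ (Fin n)) (hx : 1 ≤ ‖x‖) : q x = 0 :=
    image_eq_zero_of_notMem_tsupport fun h => absurd (hsupp h) (by simpa using hx)
  have hint (u v : MvPolynomial (Fin n) ℝ) :
      ∫ x in Metric.ball (0 : EuclideanSpace ℝ (Fin n)) 1,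
        q x * eval (fun i => x i) u * eval (fun i => x i) v =
      ∫ x : EuclideanSpace ℝ (Fin n), q x * eval (fun i => x i) u * eval (fun i => x i) v := by
    refine setIntegral_eq_integral_of_forall_compl_eq_zero fun x hx => ?_
    rw [hout x (by simpa using hx), zero_mul, zero_mul]
  simp only [hint]
  refine ⟨fun hrad d e hde u v hu hv hud hve => integral_radial_mul_harmonic_mul_harmonic
    ⟨0, by omega⟩ hq' hsupp hrad hde hu hv hud hve, fun H x y hxy => ?_⟩
  have hqc : HasCompactSupport q :=
    (isCompact_closedBall (0 : EuclideanSpace ℝ (Fin n)) 1).of_isClosed_subset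
      (isClosed_tsupport q) (hsupp.trans Metric.ball_subset_closedBall)
  refine radial_of_integral_mul_inner_pow_eq hq' (fun x hx => hout x hx.le)
    (fun a y k hay => ?_) hxy
  obtain ⟨b, c, s, hab, hnorm, hcs, rfl⟩ := exists_rotation_of_norm_eq hn hay
  exact (integral_mul_inner_rotation_pow hq' hqc
    (fun j l hjl => integral_mul_planePower_mul_conj_eq_zero hq' hqc H hab hnorm hjl) hcs k).symm
end

section
/- Let a be a zero-order symbol on ℝⁿ and let M = sSup {|a(x, ξ)| : x ∈ ℝⁿ, ξ ≠ 0}. Then for every ε > 0 there exists an infinitely differentiable compactly supported f : ℝⁿ → ℂ with ∫ |f(x)|² dx = 1 and (∫ |(A f)(x)|² dx)^{1/2} > M − ε. Equivalently, the L²-operator norm of the quantization A on test functions is at least the sup-norm of the symbol a. -/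
open MeasureTheory Filter Complex
open scoped RealInnerProductSpace

noncomputable section

/-- The (unnormalized) Fourier transform `û(ξ) = ∫ e^{−i⟨y,ξ⟩} u(y) dy`. -/
def ft {n : ℕ} (u : EuclideanSpace ℝ (Fin n) → ℂ) (ξ : EuclideanSpace ℝ (Fin n)) : ℂ :=
  ∫ y, Complex.exp (-Complex.I * (⟪y, ξ⟫ : ℂ)) * u y

/-- The quantization `(A u)(x) = (2π)^{−n} ∫ e^{i⟨x,ξ⟩} a(x,ξ) û(ξ) dξ` of a symbol `a`. -/
def quant {n : ℕ} (a : EuclideanSpace ℝ (Fin n) × EuclideanSpace ℝ (Fin n) → ℂ)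
    (u : EuclideanSpace ℝ (Fin n) → ℂ) (x : EuclideanSpace ℝ (Fin n)) : ℂ :=
  (((2 * Real.pi) ^ n : ℝ) : ℂ)⁻¹ *
    ∫ ξ, Complex.exp (Complex.I * (⟪x, ξ⟫ : ℂ)) * a (x, ξ) * ft u ξ

/-- A zero-order symbol on `ℝⁿ`: smooth away from `ξ = 0`, positively homogeneous of degree
zero in `ξ`, and compactly supported in `x`. -/
def IsZeroOrderSymbol {n : ℕ}
    (a : EuclideanSpace ℝ (Fin n) × EuclideanSpace ℝ (Fin n) → ℂ) : Prop :=
  ContDiffOn ℝ (⊤ : ℕ∞) a {p : EuclideanSpace ℝ (Fin n) × EuclideanSpace ℝ (Fin n) | p.2 ≠ 0} ∧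
  (∀ (x ξ : EuclideanSpace ℝ (Fin n)), ξ ≠ 0 → ∀ c : ℝ, 0 < c → a (x, c • ξ) = a (x, ξ)) ∧
  ∃ K : Set (EuclideanSpace ℝ (Fin n)), IsCompact K ∧
    ∀ (x ξ : EuclideanSpace ℝ (Fin n)), x ∉ K → a (x, ξ) = 0

/-- The modulation `y ↦ e^{i⟨y,ζ⟩} u(y)` of a function `u` by the frequency `ζ`. -/
def modulate {n : ℕ} (ζ : EuclideanSpace ℝ (Fin n)) (u : EuclideanSpace ℝ (Fin n) → ℂ)
    (y : EuclideanSpace ℝ (Fin n)) : ℂ :=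
  Complex.exp (Complex.I * (⟪y, ζ⟫ : ℂ)) * u y

lemma norm_modulate {n : ℕ} (ζ : EuclideanSpace ℝ (Fin n)) (u : EuclideanSpace ℝ (Fin n) → ℂ)
    (y : EuclideanSpace ℝ (Fin n)) : ‖modulate ζ u y‖ = ‖u y‖ := by
  rw [modulate, norm_mul, norm_exp_I_mul_ofReal, one_mul]

lemma contDiff_modulate {n : ℕ} (ζ : EuclideanSpace ℝ (Fin n))
    {u : EuclideanSpace ℝ (Fin n) → ℂ} (hu : ContDiff ℝ (⊤ : ℕ∞) u) :
    ContDiff ℝ (⊤ : ℕ∞) (modulate ζ u) := by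
  have h : ContDiff ℝ (⊤ : ℕ∞)
      (fun y : EuclideanSpace ℝ (Fin n) => Complex.I * ((⟪y, ζ⟫ : ℝ) : ℂ)) :=
    contDiff_const.mul (Complex.ofRealCLM.contDiff.comp (contDiff_id.inner ℝ contDiff_const))
  exact h.cexp.mul hu

lemma hasCompactSupport_modulate {n : ℕ} (ζ : EuclideanSpace ℝ (Fin n))
    {u : EuclideanSpace ℝ (Fin n) → ℂ} (hu : HasCompactSupport u) :
    HasCompactSupport (modulate ζ u) :=
  hu.mul_left

lemma ft_modulate {n : ℕ} (ζ : EuclideanSpace ℝ (Fin n)) (u : EuclideanSpace ℝ (Fin n) → ℂ)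
    (ξ : EuclideanSpace ℝ (Fin n)) : ft (modulate ζ u) ξ = ft u (ξ - ζ) := by
  unfold ft modulate
  congr 1 with y
  rw [← mul_assoc, ← Complex.exp_add, inner_sub_right]
  congr 2
  push_cast
  ring

lemma quant_modulate {n : ℕ} (a : EuclideanSpace ℝ (Fin n) × EuclideanSpace ℝ (Fin n) → ℂ)
    (ζ : EuclideanSpace ℝ (Fin n)) (u : EuclideanSpace ℝ (Fin n) → ℂ)
    (x : EuclideanSpace ℝ (Fin n)) :
    quant a (modulate ζ u) x = modulate ζ (quant (fun p => a (p.1, p.2 + ζ)) u) x := by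
  unfold quant
  rw [modulate, mul_left_comm, ← integral_const_mul (Complex.exp _),
    ← integral_add_right_eq_self _ ζ]
  congr 2 with ξ
  rw [ft_modulate, add_sub_cancel_right, inner_add_right, Complex.ofReal_add, mul_add,
    Complex.exp_add]
  ring

lemma ft_eq_fourier {n : ℕ} (u : EuclideanSpace ℝ (Fin n) → ℂ) (ξ : EuclideanSpace ℝ (Fin n)) :
    ft u ξ = FourierTransform.fourier u ((2 * Real.pi)⁻¹ • ξ) := by
  rw [Real.fourier_eq', ft]
  congr 1 with y
  rw [smul_eq_mul, inner_smul_right]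
  congr 2
  have : (Real.pi : ℂ) ≠ 0 := by exact_mod_cast Real.pi_ne_zero
  push_cast
  field_simp

lemma integrable_ft {n : ℕ} (φ : SchwartzMap (EuclideanSpace ℝ (Fin n)) ℂ) :
    Integrable (ft φ) := by
  have h : ft φ = fun ξ => (FourierTransform.fourier φ) ((2 * Real.pi)⁻¹ • ξ) := by
    ext ξ
    rw [ft_eq_fourier, SchwartzMap.fourier_coe]
  rw [h]
  exact (FourierTransform.fourier φ).integrable.comp_smul (by positivity)

lemma inversion_ft {n : ℕ} (φ : SchwartzMap (EuclideanSpace ℝ (Fin n)) ℂ)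
    (x : EuclideanSpace ℝ (Fin n)) :
    (((2 * Real.pi) ^ n : ℝ) : ℂ)⁻¹ *
      ∫ ξ, Complex.exp (Complex.I * (⟪x, ξ⟫ : ℂ)) * ft φ ξ = φ x := by
  have h1 : (fun ξ => Complex.exp (Complex.I * (⟪x, ξ⟫ : ℂ)) * ft φ ξ) = fun ξ =>
      (fun w => Complex.exp (((2 * Real.pi * ⟪w, x⟫ : ℝ) : ℂ) * Complex.I) •
        FourierTransform.fourier (φ : EuclideanSpace ℝ (Fin n) → ℂ) w)
        ((2 * Real.pi)⁻¹ • ξ) := by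
    ext ξ
    rw [ft_eq_fourier]
    dsimp only
    rw [smul_eq_mul]
    congr 2
    rw [real_inner_smul_left, real_inner_comm]
    have : (Real.pi : ℂ) ≠ 0 := by exact_mod_cast Real.pi_ne_zero
    push_cast
    field_simp
  have h2 := congrArg (fun f => f x)
    (φ.continuous.fourierInv_fourier_eq φ.integrable (FourierTransform.fourier φ).integrable)
  simp only [Real.fourierInv_eq'] at h2
  have h3 := Measure.integral_comp_inv_smul volume
    (fun w : EuclideanSpace ℝ (Fin n) =>
      Complex.exp (((2 * Real.pi * ⟪w, x⟫ : ℝ) : ℂ) * Complex.I) •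
      FourierTransform.fourier (φ : EuclideanSpace ℝ (Fin n) → ℂ) w) (2 * Real.pi)
  rw [h1, h3, h2, finrank_euclideanSpace_fin,
    abs_of_pos (by positivity), Complex.real_smul, ← mul_assoc, inv_mul_cancel₀, one_mul]
  exact_mod_cast (by positivity : (2 * Real.pi) ^ n ≠ 0)

lemma ae_add_ne_zero {n : ℕ} (hn : 1 ≤ n) (ζ : EuclideanSpace ℝ (Fin n)) :
    ∀ᵐ ξ : EuclideanSpace ℝ (Fin n), ξ + ζ ≠ 0 := by
  have : Nonempty (Fin n) := ⟨⟨0, hn⟩⟩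
  filter_upwards [compl_mem_ae_iff.2 (measure_singleton (μ := volume) (-ζ))] with ξ hξ h
  exact hξ (eq_neg_of_add_eq_zero_left h)

namespace IsZeroOrderSymbol

variable {n : ℕ} {a : EuclideanSpace ℝ (Fin n) × EuclideanSpace ℝ (Fin n) → ℂ}

lemma continuousAt (ha : IsZeroOrderSymbol a) {x ξ : EuclideanSpace ℝ (Fin n)} (hξ : ξ ≠ 0) :
    ContinuousAt a (x, ξ) :=
  ha.1.continuousOn.continuousAt
    ((isOpen_ne_fun continuous_snd continuous_const).mem_nhds hξ)

lemma exists_bound (ha : IsZeroOrderSymbol a) :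
    ∃ C : ℝ, ∀ x ξ : EuclideanSpace ℝ (Fin n), ξ ≠ 0 → ‖a (x, ξ)‖ ≤ C := by
  obtain ⟨K, hK, haK⟩ := ha.2.2
  have hKS := hK.prod (isCompact_sphere (0 : EuclideanSpace ℝ (Fin n)) 1)
  obtain ⟨C, hC⟩ := hKS.exists_bound_of_continuousOn
    (ha.1.continuousOn.mono fun p hp => ne_zero_of_mem_unit_sphere ⟨p.2, hp.2⟩)
  refine ⟨max C 0, fun x ξ hξ => ?_⟩
  by_cases hx : x ∈ K
  · rw [← ha.2.1 x ξ hξ ‖ξ‖⁻¹ (inv_pos.2 (norm_pos_iff.2 hξ))]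
    refine (hC _ ⟨hx, ?_⟩).trans (le_max_left _ _)
    simp [norm_smul, hξ]
  · rw [haK x ξ hx, norm_zero]
    exact le_max_right _ _

lemma aestronglyMeasurable_integrand (ha : IsZeroOrderSymbol a) (hn : 1 ≤ n)
    (φ : SchwartzMap (EuclideanSpace ℝ (Fin n)) ℂ) (ζ x : EuclideanSpace ℝ (Fin n)) :
    AEStronglyMeasurable
      (fun ξ => Complex.exp (Complex.I * (⟪x, ξ⟫ : ℂ)) * a (x, ξ + ζ) * ft φ ξ) volume := by
  refine AEStronglyMeasurable.mul (AEStronglyMeasurable.mul ?_ ?_)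
    (integrable_ft φ).aestronglyMeasurable
  · exact Continuous.aestronglyMeasurable (by fun_prop)
  · have hc : ContinuousOn (fun ξ => a (x, ξ + ζ)) {ξ | ξ + ζ ≠ 0} := fun ξ hξ =>
      ((ha.continuousAt hξ).comp (f := fun ξ => (x, ξ + ζ))
        (by fun_prop)).continuousWithinAt
    have hm : MeasurableSet {ξ : EuclideanSpace ℝ (Fin n) | ξ + ζ ≠ 0} :=
      (isOpen_ne_fun (by fun_prop) continuous_const).measurableSet
    have := hc.aestronglyMeasurable (μ := volume) hm
    rwa [Measure.restrict_eq_self_of_ae_mem (s := {ξ | ξ + ζ ≠ 0})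
      (ae_add_ne_zero hn ζ)] at this

lemma norm_integrand_le {C : ℝ}
    (hC : ∀ x ξ : EuclideanSpace ℝ (Fin n), ξ ≠ 0 → ‖a (x, ξ)‖ ≤ C) (hn : 1 ≤ n)
    (u : EuclideanSpace ℝ (Fin n) → ℂ) (ζ x : EuclideanSpace ℝ (Fin n)) :
    ∀ᵐ ξ, ‖Complex.exp (Complex.I * (⟪x, ξ⟫ : ℂ)) * a (x, ξ + ζ) * ft u ξ‖ ≤ C * ‖ft u ξ‖ := by
  filter_upwards [ae_add_ne_zero hn ζ] with ξ hξ
  rw [norm_mul, norm_mul, norm_exp_I_mul_ofReal, one_mul]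
  gcongr
  exact hC _ _ hξ

lemma continuous_quant_shift (ha : IsZeroOrderSymbol a) (hn : 1 ≤ n)
    (φ : SchwartzMap (EuclideanSpace ℝ (Fin n)) ℂ) (ζ : EuclideanSpace ℝ (Fin n)) :
    Continuous (quant (fun p => a (p.1, p.2 + ζ)) φ) := by
  obtain ⟨C, hC⟩ := ha.exists_bound
  refine continuous_const.mul (continuous_of_dominated
    (ha.aestronglyMeasurable_integrand hn φ ζ) (norm_integrand_le hC hn φ ζ)
    ((integrable_ft φ).norm.const_mul C) ?_)
  filter_upwards [ae_add_ne_zero hn ζ] with ξ hξ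
  refine (Continuous.mul (by fun_prop) ?_).mul continuous_const
  exact continuous_iff_continuousAt.2 fun x =>
    (ha.continuousAt hξ).comp (f := fun x => (x, ξ + ζ)) (by fun_prop)

lemma tendsto_quant_shift (ha : IsZeroOrderSymbol a) (hn : 1 ≤ n)
    (φ : SchwartzMap (EuclideanSpace ℝ (Fin n)) ℂ) {ξ₀ : EuclideanSpace ℝ (Fin n)}
    (hξ₀ : ξ₀ ≠ 0) (x : EuclideanSpace ℝ (Fin n)) :
    Tendsto (fun t : ℝ => quant (fun p => a (p.1, p.2 + t • ξ₀)) φ x) atTop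
      (nhds (a (x, ξ₀) * φ x)) := by
  obtain ⟨C, hC⟩ := ha.exists_bound
  have hlim : (((2 * Real.pi) ^ n : ℝ) : ℂ)⁻¹ *
      ∫ ξ, Complex.exp (Complex.I * (⟪x, ξ⟫ : ℂ)) * a (x, ξ₀) * ft φ ξ = a (x, ξ₀) * φ x := by
    rw [← inversion_ft φ x, mul_left_comm (a (x, ξ₀)), ← integral_const_mul (a (x, ξ₀))]
    congr 2 with ξ
    ring
  rw [← hlim]
  refine Tendsto.const_mul _ (tendsto_integral_filter_of_dominated_convergence
    (fun ξ => C * ‖ft φ ξ‖) (.of_forall fun t => ha.aestronglyMeasurable_integrand hn φ _ x)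
    (.of_forall fun t => norm_integrand_le hC hn φ _ x)
    ((integrable_ft φ).norm.const_mul C) (.of_forall fun ξ => ?_))
  refine Tendsto.mul_const _ (Tendsto.const_mul _ ?_)
  have hdir : Tendsto (fun t : ℝ => t⁻¹ • ξ + ξ₀) atTop (nhds ξ₀) := by
    simpa only [zero_smul, zero_add] using
      ((tendsto_inv_atTop_zero (𝕜 := ℝ)).smul_const ξ).add_const ξ₀
  refine ((ha.continuousAt hξ₀).tendsto.comp
    ((tendsto_const_nhds (x := x)).prodMk_nhds hdir)).congr' ?_
  filter_upwards [eventually_gt_atTop 0, hdir.eventually_ne hξ₀] with t ht hne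
  rw [Function.comp_apply, ← ha.2.1 x _ hne t ht, smul_add, smul_inv_smul₀ ht.ne']

/-- High-frequency modulation freezes the symbol at the direction of the frequency. -/
lemma tendsto_integral_norm_quant_modulate (ha : IsZeroOrderSymbol a) (hn : 1 ≤ n)
    (φ : SchwartzMap (EuclideanSpace ℝ (Fin n)) ℂ) {ξ₀ : EuclideanSpace ℝ (Fin n)}
    (hξ₀ : ξ₀ ≠ 0) :
    Tendsto (fun t : ℝ => ∫ x, ‖quant a (modulate (t • ξ₀) φ) x‖ ^ 2) atTop
      (nhds (∫ x, ‖a (x, ξ₀) * φ x‖ ^ 2)) := by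
  simp_rw [quant_modulate, norm_modulate]
  obtain ⟨C, hC⟩ := ha.exists_bound
  obtain ⟨K, hK, haK⟩ := ha.2.2
  set B : ℝ := ‖(((2 * Real.pi) ^ n : ℝ) : ℂ)⁻¹‖ * ∫ ξ, C * ‖ft φ ξ‖ with hB
  refine tendsto_integral_filter_of_dominated_convergence (K.indicator fun _ => B ^ 2)
    (.of_forall fun t =>
      ((ha.continuous_quant_shift hn φ (t • ξ₀)).norm.pow 2).aestronglyMeasurable)
    (.of_forall fun t => .of_forall fun x => ?_)
    ((integrable_indicator_iff hK.measurableSet).2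
      (integrableOn_const hK.measure_lt_top.ne))
    (.of_forall fun x => (ha.tendsto_quant_shift hn φ hξ₀ x).norm.pow 2)
  by_cases hx : x ∈ K
  · rw [Set.indicator_of_mem hx, norm_pow, norm_norm]
    gcongr
    rw [quant, norm_mul, hB]
    gcongr
    exact norm_integral_le_of_norm_le ((integrable_ft φ).norm.const_mul C)
      (norm_integrand_le hC hn φ _ x)
  · simp [Set.indicator_of_notMem hx, quant, haK _ _ hx]

end IsZeroOrderSymbol

lemma integrable_norm_sq {n : ℕ} {u : EuclideanSpace ℝ (Fin n) → ℂ} (hu : Continuous u)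
    (huc : HasCompactSupport u) : Integrable fun x => ‖u x‖ ^ 2 := by
  have h : HasCompactSupport fun x => ‖u x‖ ^ 2 :=
    huc.comp_left (g := fun z : ℂ => ‖z‖ ^ 2) (by simp)
  exact Continuous.integrable_of_hasCompactSupport (by fun_prop) h

lemma exists_contDiff_integral_norm_sq_eq_one {n : ℕ} (x₀ : EuclideanSpace ℝ (Fin n)) {r : ℝ}
    (hr : 0 < r) :
    ∃ φ : EuclideanSpace ℝ (Fin n) → ℂ, ContDiff ℝ (⊤ : ℕ∞) φ ∧ HasCompactSupport φ ∧
      Function.support φ ⊆ Metric.ball x₀ r ∧ (∫ x, ‖φ x‖ ^ 2) = 1 := by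
  let b : ContDiffBump x₀ := ⟨r / 2, r, by positivity, by linarith⟩
  have hb2 : HasCompactSupport fun x => b x ^ 2 := by
    exact b.hasCompactSupport.comp_left (g := fun t : ℝ => t ^ 2) (by simp)
  have hI : 0 < ∫ x, b x ^ 2 := by
    refine (b.continuous.pow 2).integral_pos_of_hasCompactSupport_nonneg_nonzero hb2
      (fun x => sq_nonneg _) (x := x₀) ?_
    have : b x₀ = 1 := b.one_of_mem_closedBall (Metric.mem_closedBall_self b.rIn_pos.le)
    simp [this]
  set s := Real.sqrt (∫ x, b x ^ 2) with hs
  refine ⟨fun x => ((s⁻¹ * b x : ℝ) : ℂ), ?_, ?_, ?_, ?_⟩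
  · exact Complex.ofRealCLM.contDiff.comp (contDiff_const.mul b.contDiff)
  · exact (b.hasCompactSupport.mul_left (f := fun _ => s⁻¹)).comp_left
      (g := fun t : ℝ => (t : ℂ)) Complex.ofReal_zero
  · intro x hx
    have : b x ≠ 0 := fun h => hx (by simp [h])
    exact b.support_eq ▸ this
  · simp_rw [Complex.norm_real, Real.norm_eq_abs, sq_abs, mul_pow]
    rw [integral_const_mul, inv_pow, hs, Real.sq_sqrt hI.le, inv_mul_cancel₀ hI.ne']

theorem stmt9 (n : ℕ) (hn : 1 ≤ n)
    (a : EuclideanSpace ℝ (Fin n) × EuclideanSpace ℝ (Fin n) → ℂ)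
    (ha : IsZeroOrderSymbol a)
    (M : ℝ)
    (hM : M = sSup {r : ℝ | ∃ (x ξ : EuclideanSpace ℝ (Fin n)), ξ ≠ 0 ∧ r = ‖a (x, ξ)‖}) :
    ∀ ε : ℝ, 0 < ε →
      ∃ f : EuclideanSpace ℝ (Fin n) → ℂ, ContDiff ℝ (⊤ : ℕ∞) f ∧ HasCompactSupport f ∧
        (∫ x, ‖f x‖ ^ 2) = 1 ∧ Real.sqrt (∫ x, ‖quant a f x‖ ^ 2) > M - ε := by
  intro ε hε
  have hne : {r : ℝ | ∃ (x ξ : EuclideanSpace ℝ (Fin n)), ξ ≠ 0 ∧ r = ‖a (x, ξ)‖}.Nonempty := by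
    have : Nonempty (Fin n) := ⟨⟨0, hn⟩⟩
    obtain ⟨ξ, hξ⟩ := exists_ne (0 : EuclideanSpace ℝ (Fin n))
    exact ⟨_, 0, ξ, hξ, rfl⟩
  obtain ⟨_, ⟨x₀, ξ₀, hξ₀, rfl⟩, hlt⟩ := exists_lt_of_lt_csSup hne
    ((sub_lt_self M hε).trans_eq hM)
  obtain ⟨c, hc, hc'⟩ := exists_between hlt
  have hcont : Continuous fun x => a (x, ξ₀) := continuous_iff_continuousAt.2 fun x =>
    (ha.continuousAt hξ₀).comp (f := fun x => (x, ξ₀)) (by fun_prop)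
  obtain ⟨r, hr, hball⟩ := Metric.eventually_nhds_iff_ball.1
    (hcont.norm.continuousAt.eventually (lt_mem_nhds hc'))
  obtain ⟨φ, hφ, hφc, hφs, hφ1⟩ := exists_contDiff_integral_norm_sq_eq_one x₀ hr
  have hlim := ha.tendsto_integral_norm_quant_modulate hn (hφc.toSchwartzMap hφ) hξ₀
  have hmod : ∀ t : ℝ, ContDiff ℝ (⊤ : ℕ∞) (modulate (t • ξ₀) φ) ∧
      HasCompactSupport (modulate (t • ξ₀) φ) ∧ (∫ x, ‖modulate (t • ξ₀) φ x‖ ^ 2) = 1 :=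
    fun t => ⟨contDiff_modulate _ hφ, hasCompactSupport_modulate _ hφc, by
      simpa only [norm_modulate] using hφ1⟩
  suffices h : ∃ t : ℝ, M - ε < Real.sqrt (∫ x, ‖quant a (modulate (t • ξ₀) φ) x‖ ^ 2) by
    obtain ⟨t, ht⟩ := h
    exact ⟨_, (hmod t).1, (hmod t).2.1, (hmod t).2.2, ht⟩
  rcases lt_or_ge (M - ε) 0 with hneg | hnonneg
  · exact ⟨0, hneg.trans_le (Real.sqrt_nonneg _)⟩
  have hle : c ^ 2 ≤ ∫ x, ‖a (x, ξ₀) * φ x‖ ^ 2 := by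
    calc c ^ 2 = ∫ x, c ^ 2 * ‖φ x‖ ^ 2 := by rw [integral_const_mul, hφ1, mul_one]
      _ ≤ ∫ x, ‖a (x, ξ₀) * φ x‖ ^ 2 := by
        refine integral_mono ((integrable_norm_sq hφ.continuous hφc).const_mul _)
          (integrable_norm_sq (hcont.mul hφ.continuous) hφc.mul_left) fun x => ?_
        simp only [norm_mul, mul_pow]
        by_cases hx : φ x = 0
        · simp [hx]
        · have := hball x (hφs hx)
          have : 0 ≤ c := hnonneg.trans hc.le
          gcongr
  obtain ⟨t, ht⟩ := (hlim.eventually (lt_mem_nhds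
    ((pow_lt_pow_left₀ hc hnonneg two_ne_zero).trans_le hle))).exists
  exact ⟨t, Real.lt_sqrt_of_sq_lt ht⟩
end
end
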